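/- Let (Ω, μ) be a σ-finite measure space, let p ∈ [1, ∞), let K be a positive bounded linear operator on L^p(Ω, μ; ℝ) which is an integral operator, and let T be a positive bounded linear operator on L^p. Then both compositions K ∘ T and T ∘ K are integral operators. -/

import Mathlib

open MeasureTheory Filter
open scoped ENNReal NNReal

noncomputable section

/-- A bounded linear operator on `L^p` is positive if it maps a.e.-nonnegative functions
to a.e.-nonnegative functions. -/
def IsPositiveOp {Ω : Type*} [MeasurableSpace Ω] {μ : Measure Ω} {p : ℝ≥0∞} [Fact (1 ≤ p)]
    (T : Lp ℝ p μ →L[ℝ] Lp ℝ p μ) : Prop :=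
  ∀ f : Lp ℝ p μ, 0 ≤ f → 0 ≤ T f

/-- A bounded linear operator on `L^p` is an integral operator if there is a
nonnegative measurable kernel `k : Ω × Ω → [0,∞)` such that for every `f ∈ L^p` the
function `x ↦ k x y * f x` is integrable for a.e. `y` and
`(T f)(y) = ∫ k x y * f x dμ(x)` for a.e. `y`. -/
def IsIntegralOp {Ω : Type*} [MeasurableSpace Ω] {μ : Measure Ω} {p : ℝ≥0∞} [Fact (1 ≤ p)]
    (T : Lp ℝ p μ →L[ℝ] Lp ℝ p μ) : Prop :=
  ∃ k : Ω → Ω → ℝ, Measurable (Function.uncurry k) ∧ (∀ x y, 0 ≤ k x y) ∧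
    ∀ f : Lp ℝ p μ,
      (∀ᵐ y ∂μ, Integrable (fun x => k x y * f x) μ) ∧
      (T f : Ω → ℝ) =ᵐ[μ] fun y => ∫ x, k x y * f x ∂μ

theorem tendsto_Lp_of_dominated {Ω : Type*} [MeasurableSpace Ω] {μ : Measure Ω} {p : ℝ≥0∞}
    [Fact (1 ≤ p)] (hp : p ≠ ∞) {f : ℕ → Lp ℝ p μ} {g b : Lp ℝ p μ}
    (hb : ∀ n, ∀ᵐ x ∂μ, |f n x| ≤ b x) (h : ∀ᵐ x ∂μ, Tendsto (fun n => f n x) atTop (nhds (g x))) :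
    Tendsto f atTop (nhds g) := by
  have hp0 : p ≠ 0 := (zero_lt_one.trans_le (Fact.out : 1 ≤ p)).ne'
  have hpr : 0 < p.toReal := ENNReal.toReal_pos hp0 hp
  have hball : ∀ᵐ x ∂μ, ∀ n, |f n x| ≤ b x := ae_all_iff.2 hb
  have hbfin : ∫⁻ x, (‖(2 : ℝ) * b x‖ₑ) ^ p.toReal ∂μ ≠ ∞ :=
    (lintegral_rpow_enorm_lt_top_of_eLpNorm_lt_top hp0 hp
      ((Lp.memLp b).const_mul 2).2).ne
  rw [Lp.tendsto_Lp_iff_tendsto_eLpNorm']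
  simp_rw [eLpNorm_eq_lintegral_rpow_enorm_toReal hp0 hp]
  have key : Tendsto (fun n => ∫⁻ x, ‖(⇑(f n) - ⇑g) x‖ₑ ^ p.toReal ∂μ) atTop
      (nhds (∫⁻ _, 0 ∂μ)) := by
    refine tendsto_lintegral_of_dominated_convergence'
      (fun x => ‖(2 : ℝ) * b x‖ₑ ^ p.toReal) (fun n => ?_) (fun n => ?_) hbfin ?_
    · exact ((Lp.aestronglyMeasurable _).sub (Lp.aestronglyMeasurable _)).enorm.pow_const _
    · filter_upwards [hball, h] with x hx hgx
      have hg : |g x| ≤ b x := le_of_tendsto' hgx.abs hx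
      refine ENNReal.rpow_le_rpow ?_ hpr.le
      rw [enorm_le_iff_norm_le, Real.norm_eq_abs, Real.norm_eq_abs, Pi.sub_apply]
      have := hx n
      rw [abs_le] at this hg
      refine le_trans ?_ (le_abs_self _)
      rw [abs_le]
      constructor <;> linarith [this.1, this.2, hg.1, hg.2]
    · filter_upwards [h] with x hx
      have h1 : Tendsto (fun n => ‖f n x - g x‖ₑ) atTop (nhds 0) := by
        have := (hx.sub_const (g x)).enorm
        simpa using this
      have := h1.ennrpow_const p.toReal
      simpa [ENNReal.zero_rpow_of_pos hpr] using this
  have := key.ennrpow_const (1 / p.toReal)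
  simpa [ENNReal.zero_rpow_of_pos, hpr] using this

theorem ae_iSup_ofReal_map_eq {Ω : Type*} [MeasurableSpace Ω] {μ : Measure Ω} {p : ℝ≥0∞}
    [Fact (1 ≤ p)] (hp : p ≠ ∞) {U : Lp ℝ p μ →L[ℝ] Lp ℝ p μ} (hU : IsPositiveOp U)
    {f : ℕ → Lp ℝ p μ} {g : Lp ℝ p μ} (h0 : 0 ≤ f 0) (hf : Monotone f)
    (h : ∀ᵐ x ∂μ, Tendsto (fun n => f n x) atTop (nhds (g x))) :
    ∀ᵐ y ∂μ, Monotone (fun n => ENNReal.ofReal (U (f n) y)) ∧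
      ⨆ n, ENNReal.ofReal (U (f n) y) = ENNReal.ofReal (U g y) := by
  have hmono : ∀ᵐ x ∂μ, Monotone fun n => f n x := by
    have : ∀ n, f n ≤ᵐ[μ] f (n + 1) := fun n => (Lp.coeFn_le _ _).2 (hf n.le_succ)
    filter_upwards [ae_all_iff.2 this] with x hx using monotone_nat_of_le_succ hx
  have hle : ∀ n, ∀ᵐ x ∂μ, |f n x| ≤ g x := fun n => by
    filter_upwards [hmono, h, (Lp.coeFn_nonneg _).2 h0] with x hx hgx h0x
    rw [abs_of_nonneg (le_trans h0x (hx n.zero_le))]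
    exact hx.ge_of_tendsto hgx n
  have hT : Tendsto (fun n => U (f n)) atTop (nhds (U g)) :=
    (U.continuous.tendsto g).comp (tendsto_Lp_of_dominated hp hle h)
  have hUmono : ∀ n, U (f n) ≤ᵐ[μ] U (f (n + 1)) := fun n => by
    rw [Lp.coeFn_le, ← sub_nonneg, ← map_sub]
    exact hU _ (sub_nonneg.2 (hf n.le_succ))
  obtain ⟨ns, hns, hlim⟩ := (tendstoInMeasure_of_tendsto_Lp hT).exists_seq_tendsto_ae
  filter_upwards [ae_all_iff.2 hUmono, hlim] with y hy hly
  have hm : Monotone fun n => ENNReal.ofReal (U (f n) y) :=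
    fun i j hij => ENNReal.ofReal_le_ofReal (monotone_nat_of_le_succ hy hij)
  refine ⟨hm, ?_⟩
  have h1 : Tendsto (fun n => ENNReal.ofReal (U (f (ns n)) y)) atTop
      (nhds (ENNReal.ofReal (U g y))) := ENNReal.tendsto_ofReal hly
  exact tendsto_nhds_unique ((tendsto_atTop_iSup hm).comp hns.tendsto_atTop) h1

/-- The function `A.indicator h` as an element of `L^p` (zero if `A` is not measurable). -/
def indicatorLp {Ω : Type*} [MeasurableSpace Ω] {μ : Measure Ω} {p : ℝ≥0∞}
    (h : Lp ℝ p μ) (A : Set Ω) : Lp ℝ p μ :=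
  open Classical in
  if hA : MeasurableSet A then ((Lp.memLp h).indicator hA).toLp _ else 0

theorem coeFn_indicatorLp {Ω : Type*} [MeasurableSpace Ω] {μ : Measure Ω} {p : ℝ≥0∞}
    (h : Lp ℝ p μ) {A : Set Ω} (hA : MeasurableSet A) :
    indicatorLp h A =ᵐ[μ] A.indicator h := by
  rw [indicatorLp, dif_pos hA]
  exact MemLp.coeFn_toLp _

theorem exists_pos_Lp {Ω : Type*} [MeasurableSpace Ω] (μ : Measure Ω) [SigmaFinite μ] {p : ℝ≥0∞} :
    ∃ h : Lp ℝ p μ, ∀ᵐ x ∂μ, 0 < h x := by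
  obtain ⟨g, hg0, hgm, hg⟩ := exists_pos_lintegral_lt_of_sigmaFinite μ one_ne_zero
  have h1 : MemLp (fun x => (g x : ℝ)) 1 μ := by
    rw [memLp_one_iff_integrable]
    refine ⟨hgm.coe_nnreal_real.aestronglyMeasurable, ?_⟩
    rw [hasFiniteIntegral_iff_enorm]
    simpa using hg.trans ENNReal.one_lt_top
  have h2 := h1.norm_rpow_div (1 / p)
  rw [one_div, one_div, inv_inv] at h2
  refine ⟨h2.toLp _, ?_⟩
  filter_upwards [h2.coeFn_toLp] with x hx
  rw [hx]
  exact Real.rpow_pos_of_pos (norm_pos_iff.2 (by exact_mod_cast (hg0 x).ne')) _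

theorem indicatorLp_nonneg {Ω : Type*} [MeasurableSpace Ω] {μ : Measure Ω} {p : ℝ≥0∞}
    {h : Lp ℝ p μ} (hh : ∀ᵐ x ∂μ, 0 < h x) {A : Set Ω} (hA : MeasurableSet A) :
    0 ≤ indicatorLp h A := by
  rw [← Lp.coeFn_nonneg]
  filter_upwards [coeFn_indicatorLp h hA, hh] with x hx hhx
  rw [hx]
  exact Set.indicator_apply_nonneg (fun _ => hhx.le)

theorem ae_ofReal_map_add {Ω : Type*} [MeasurableSpace Ω] {μ : Measure Ω} {p : ℝ≥0∞}
    [Fact (1 ≤ p)] {U : Lp ℝ p μ →L[ℝ] Lp ℝ p μ} (hU : IsPositiveOp U) {f g : Lp ℝ p μ}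
    (hf : 0 ≤ f) (hg : 0 ≤ g) :
    ∀ᵐ y ∂μ, ENNReal.ofReal (U (f + g) y) = ENNReal.ofReal (U f y) + ENNReal.ofReal (U g y) := by
  rw [map_add]
  filter_upwards [Lp.coeFn_add (U f) (U g), (Lp.coeFn_nonneg _).2 (hU f hf),
    (Lp.coeFn_nonneg _).2 (hU g hg)] with y hy h1 h2
  rw [hy, Pi.add_apply, ENNReal.ofReal_add h1 h2]

theorem ae_ofReal_map_indicatorLp_iUnion {Ω : Type*} [MeasurableSpace Ω] {μ : Measure Ω}
    {p : ℝ≥0∞} [Fact (1 ≤ p)] (hp : p ≠ ∞) {U : Lp ℝ p μ →L[ℝ] Lp ℝ p μ} (hU : IsPositiveOp U)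
    {h : Lp ℝ p μ} (hh : ∀ᵐ x ∂μ, 0 < h x) {A : ℕ → Set Ω} (hA : ∀ i, MeasurableSet (A i))
    (hd : Pairwise (Function.onFun Disjoint A)) :
    ∀ᵐ y ∂μ, ENNReal.ofReal (U (indicatorLp h (⋃ i, A i)) y) =
      ∑' i, ENNReal.ofReal (U (indicatorLp h (A i)) y) := by
  have hnn : ∀ i, 0 ≤ indicatorLp h (A i) := fun i => indicatorLp_nonneg hh (hA i)
  let f : ℕ → Lp ℝ p μ := fun n => ∑ i ∈ Finset.range n, indicatorLp h (A i)
  have hf0 : ∀ n, 0 ≤ f n := fun n => Finset.sum_nonneg fun i _ => hnn i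
  have hfs : ∀ n, f (n + 1) = f n + indicatorLp h (A n) := fun n => Finset.sum_range_succ _ _
  have hf : Monotone f := monotone_nat_of_le_succ fun n => by
    rw [hfs]; exact le_add_of_nonneg_right (hnn n)
  have hz : f 0 = 0 := Finset.sum_range_zero _
  have hlim : ∀ᵐ x ∂μ,
      Tendsto (fun n => f n x) atTop (nhds (indicatorLp h (⋃ i, A i) x)) := by
    have h0 : f 0 =ᵐ[μ] 0 := by rw [hz]; exact Lp.coeFn_zero _ _ _
    have h1 : ∀ n, f (n + 1) =ᵐ[μ] f n + indicatorLp h (A n) := fun n => by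
      rw [hfs]; exact Lp.coeFn_add _ _
    filter_upwards [h0, ae_all_iff.2 h1, ae_all_iff.2 fun i => coeFn_indicatorLp h (hA i),
      coeFn_indicatorLp h (MeasurableSet.iUnion hA)] with x h0x h1x h2x h3x
    have hsum : ∀ n, f n x = ∑ i ∈ Finset.range n, (A i).indicator h x := fun n => by
      induction n with
      | zero => simpa using h0x
      | succ n ih => rw [h1x, Pi.add_apply, ih, h2x, Finset.sum_range_succ]
    simp_rw [hsum, h3x]
    refine HasSum.tendsto_sum_nat ?_
    by_cases hx : x ∈ ⋃ i, A i
    · obtain ⟨j, hj⟩ := Set.mem_iUnion.1 hx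
      rw [Set.indicator_of_mem hx, ← Set.indicator_of_mem hj (h : Ω → ℝ)]
      refine hasSum_single j fun i hij => Set.indicator_of_notMem (fun hi => ?_) _
      exact Set.disjoint_left.1 (hd hij) hi hj
    · rw [Set.indicator_of_notMem hx]
      convert! (hasSum_zero : HasSum (fun _ : ℕ => (0 : ℝ)) 0) using 2 with i
      exact Set.indicator_of_notMem (fun hi => hx (Set.mem_iUnion.2 ⟨i, hi⟩)) _
  have hz' : U (f 0) =ᵐ[μ] 0 := by rw [hz, map_zero]; exact Lp.coeFn_zero _ _ _
  filter_upwards [ae_iSup_ofReal_map_eq hp hU (hf0 0) hf hlim, hz',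
    ae_all_iff.2 fun n => ae_ofReal_map_add hU (hf0 n) (hnn n)] with y hy hy0 hys
  rw [← hy.2, ENNReal.tsum_eq_iSup_nat]
  congr 1
  funext n
  induction n with
  | zero => simp [hy0]
  | succ n ih => rw [hfs, hys, ih, Finset.sum_range_succ]

theorem map_indicatorLp_of_null {Ω : Type*} [MeasurableSpace Ω] {μ : Measure Ω}
    {p : ℝ≥0∞} [Fact (1 ≤ p)] (U : Lp ℝ p μ →L[ℝ] Lp ℝ p μ) (h : Lp ℝ p μ) {A : Set Ω}
    (hA : MeasurableSet A) (hA0 : μ A = 0) :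
    ∀ᵐ y ∂μ, ENNReal.ofReal (U (indicatorLp h A) y) = 0 := by
  have h0 : indicatorLp h A = 0 := by
    rw [Lp.eq_zero_iff_ae_eq_zero]
    exact (coeFn_indicatorLp h hA).trans (indicator_meas_zero hA0)
  rw [h0, map_zero]
  filter_upwards [Lp.coeFn_zero ℝ p μ] with y hy
  rw [hy, Pi.zero_apply, ENNReal.ofReal_zero]

theorem measurable_ofReal_Lp {Ω : Type*} [MeasurableSpace Ω] {μ : Measure Ω} {p : ℝ≥0∞}
    (f : Lp ℝ p μ) : Measurable fun x => ENNReal.ofReal (f x) :=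
  (Lp.stronglyMeasurable f).measurable.ennreal_ofReal

theorem exists_measure_map_indicatorLp {Ω : Type*} [MeasurableSpace Ω] {μ : Measure Ω}
    {p : ℝ≥0∞} [Fact (1 ≤ p)] (hp : p ≠ ∞) {U : Lp ℝ p μ →L[ℝ] Lp ℝ p μ} (hU : IsPositiveOp U)
    {h : Lp ℝ p μ} (hh : ∀ᵐ x ∂μ, 0 < h x) {w : Ω → ℝ≥0∞} (hw : Measurable w) :
    ∃ β : Measure Ω, ∀ A, MeasurableSet A →
      β A = ∫⁻ y, w y * ENNReal.ofReal (U (indicatorLp h A) y) ∂μ := by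
  refine ⟨Measure.ofMeasurable
    (fun A _ => ∫⁻ y, w y * ENNReal.ofReal (U (indicatorLp h A) y) ∂μ) ?_ ?_,
    fun A hA => Measure.ofMeasurable_apply A hA⟩
  · rw [lintegral_eq_zero_of_ae_eq_zero]
    filter_upwards [map_indicatorLp_of_null U h MeasurableSet.empty measure_empty] with y hy
    simp [hy]
  · intro A hA hd
    rw [← lintegral_tsum (f := fun i y => w y * ENNReal.ofReal (U (indicatorLp h (A i)) y))
      fun i => (hw.mul (measurable_ofReal_Lp _)).aemeasurable]
    refine lintegral_congr_ae ?_
    filter_upwards [ae_ofReal_map_indicatorLp_iUnion hp hU hh hA hd] with y hy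
    rw [hy, ENNReal.tsum_mul_left]

theorem exists_Lp_ofReal_eq_mul {Ω : Type*} [MeasurableSpace Ω] {μ : Measure Ω} {p : ℝ≥0∞}
    (h : Lp ℝ p μ) {g : Lp ℝ p μ} {φ ψ : Ω → ℝ≥0∞} (hg : 0 ≤ g) (hψ : Measurable ψ) (hle : ψ ≤ φ)
    (hgφ : ∀ᵐ x ∂μ, ENNReal.ofReal (g x) = ENNReal.ofReal (h x) * φ x) :
    ∃ g' : Lp ℝ p μ, 0 ≤ g' ∧
      ∀ᵐ x ∂μ, ENNReal.ofReal (g' x) = ENNReal.ofReal (h x) * ψ x := by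
  have hpt : ∀ᵐ x ∂μ, ENNReal.ofReal (h x) * ψ x ≤ ENNReal.ofReal (g x) := by
    filter_upwards [hgφ] with x hx
    rw [hx]
    exact mul_le_mul_right (hle x) _
  have hmem : MemLp (fun x => (ENNReal.ofReal (h x) * ψ x).toReal) p μ := by
    refine (Lp.memLp g).of_le
      ((measurable_ofReal_Lp h).mul hψ).ennreal_toReal.aestronglyMeasurable ?_
    filter_upwards [hpt, (Lp.coeFn_nonneg _).2 hg] with x hx hgx
    rw [Real.norm_of_nonneg ENNReal.toReal_nonneg, Real.norm_of_nonneg hgx]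
    exact ENNReal.toReal_le_of_le_ofReal hgx hx
  refine ⟨hmem.toLp _, ?_, ?_⟩
  · rw [← Lp.coeFn_nonneg]
    filter_upwards [hmem.coeFn_toLp] with x hx
    rw [hx]
    exact ENNReal.toReal_nonneg
  · filter_upwards [hmem.coeFn_toLp, hpt] with x hx hx'
    rw [hx, ENNReal.ofReal_toReal (hx'.trans_lt ENNReal.ofReal_lt_top).ne]

theorem lintegral_eq_of_map_indicatorLp {Ω : Type*} [MeasurableSpace Ω] {μ : Measure Ω}
    {p : ℝ≥0∞} [Fact (1 ≤ p)] (hp : p ≠ ∞) {U : Lp ℝ p μ →L[ℝ] Lp ℝ p μ} (hU : IsPositiveOp U)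
    {h : Lp ℝ p μ} (hh : ∀ᵐ x ∂μ, 0 < h x) {w : Ω → ℝ≥0∞} (hw : Measurable w) {β : Measure Ω}
    (hβ : ∀ A, MeasurableSet A →
      β A = ∫⁻ y, w y * ENNReal.ofReal (U (indicatorLp h A) y) ∂μ)
    {φ : Ω → ℝ≥0∞} (hφ : Measurable φ) (g : Lp ℝ p μ) (hg : 0 ≤ g)
    (hgφ : ∀ᵐ x ∂μ, ENNReal.ofReal (g x) = ENNReal.ofReal (h x) * φ x) :
    ∫⁻ x, φ x ∂β = ∫⁻ y, w y * ENNReal.ofReal (U g y) ∂μ := by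
  have hwm : ∀ f : Lp ℝ p μ, Measurable fun y => w y * ENNReal.ofReal (U f y) :=
    fun f => hw.mul (measurable_ofReal_Lp _)
  refine Measurable.ennreal_induction (motive := fun φ => ∀ g : Lp ℝ p μ, 0 ≤ g →
    (∀ᵐ x ∂μ, ENNReal.ofReal (g x) = ENNReal.ofReal (h x) * φ x) →
    ∫⁻ x, φ x ∂β = ∫⁻ y, w y * ENNReal.ofReal (U g y) ∂μ) ?_ ?_ ?_ hφ g hg hgφ <;>
    clear hφ hgφ φ hg g
  · intro c A hA g hg hgφ
    by_cases hA0 : μ A = 0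
    · have hg0 : g = 0 := by
        rw [Lp.eq_zero_iff_ae_eq_zero]
        filter_upwards [hgφ, (Lp.coeFn_nonneg _).2 hg, measure_eq_zero_iff_ae_notMem.1 hA0]
          with x hx hgx hxA
        rw [Set.indicator_of_notMem hxA, mul_zero, ENNReal.ofReal_eq_zero] at hx
        exact le_antisymm hx hgx
      have hβ0 : β A = 0 := by
        rw [hβ A hA, lintegral_eq_zero_of_ae_eq_zero]
        filter_upwards [map_indicatorLp_of_null U h hA hA0] with y hy
        simp [hy]
      rw [lintegral_indicator_const hA, hβ0, mul_zero, hg0, map_zero]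
      symm
      refine lintegral_eq_zero_of_ae_eq_zero ?_
      filter_upwards [Lp.coeFn_zero ℝ p μ] with y hy
      rw [hy, Pi.zero_apply, ENNReal.ofReal_zero, mul_zero, Pi.zero_apply]
    · have hc : c ≠ ∞ := by
        rintro rfl
        refine hA0 (measure_eq_zero_iff_ae_notMem.2 ?_)
        filter_upwards [hgφ, hh] with x hx hhx hxA
        rw [Set.indicator_of_mem hxA, ENNReal.mul_top (by simpa using hhx)] at hx
        exact ENNReal.ofReal_ne_top hx
      have hgc : g = c.toReal • indicatorLp h A := by
        refine Lp.ext ?_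
        filter_upwards [hgφ, (Lp.coeFn_nonneg _).2 hg, Lp.coeFn_smul c.toReal (indicatorLp h A),
          coeFn_indicatorLp h hA, hh] with x hx hgx h1 h2 hhx
        rw [h1, Pi.smul_apply, h2, ← ENNReal.toReal_ofReal hgx, hx]
        by_cases hxA : x ∈ A
        · simp [hxA, hhx.le, mul_comm]
        · simp [hxA]
      rw [lintegral_indicator_const hA, hβ A hA, hgc, map_smul,
        ← lintegral_const_mul _ (hwm _)]
      refine lintegral_congr_ae ?_
      filter_upwards [Lp.coeFn_smul c.toReal (U (indicatorLp h A))] with y hy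
      rw [hy, Pi.smul_apply, smul_eq_mul, ENNReal.ofReal_mul ENNReal.toReal_nonneg,
        ENNReal.ofReal_toReal hc]
      ring
  · intro φ ψ _ hφ hψ ih₁ ih₂ g hg hgφ
    obtain ⟨g₁, h1, h1'⟩ :=
      exists_Lp_ofReal_eq_mul h hg hφ (le_add_of_nonneg_right (b := ψ) zero_le) hgφ
    obtain ⟨g₂, h2, h2'⟩ :=
      exists_Lp_ofReal_eq_mul h hg hψ (le_add_of_nonneg_left (b := φ) zero_le) hgφ
    have hsum : g = g₁ + g₂ := by
      refine Lp.ext ?_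
      filter_upwards [h1', h2', hgφ, Lp.coeFn_add g₁ g₂, (Lp.coeFn_nonneg _).2 hg,
        (Lp.coeFn_nonneg _).2 h1, (Lp.coeFn_nonneg _).2 h2] with x a b c d e f i
      rw [Pi.add_apply, mul_add, ← a, ← b, ← ENNReal.ofReal_add f i,
        ENNReal.ofReal_eq_ofReal_iff e (add_nonneg f i)] at c
      rw [c, d, Pi.add_apply]
    simp only [Pi.add_apply]
    rw [lintegral_add_left hφ, ih₁ g₁ h1 h1', ih₂ g₂ h2 h2', hsum,
      ← lintegral_add_left (hwm _)]
    refine lintegral_congr_ae ?_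
    filter_upwards [ae_ofReal_map_add hU h1 h2] with y hy
    rw [hy, mul_add]
  · intro φ hφ hmono ih g hg hgφ
    choose f hf0 hf' using fun n =>
      exists_Lp_ofReal_eq_mul h hg (hφ n) (fun x => le_iSup (fun n => φ n x) n) hgφ
    have hfm : Monotone f := monotone_nat_of_le_succ fun n => by
      rw [← Lp.coeFn_le]
      filter_upwards [hf' n, hf' (n + 1), (Lp.coeFn_nonneg _).2 (hf0 (n + 1))] with x a b c
      rw [← ENNReal.ofReal_le_ofReal_iff c, a, b]
      exact mul_le_mul_right (hmono n.le_succ x) _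
    have hlim : ∀ᵐ x ∂μ, Tendsto (fun n => f n x) atTop (nhds (g x)) := by
      filter_upwards [ae_all_iff.2 hf', hgφ, (Lp.coeFn_nonneg _).2 hg,
        ae_all_iff.2 fun n => (Lp.coeFn_nonneg _).2 (hf0 n)] with x a b c d
      have h1 : Tendsto (fun n => ENNReal.ofReal (f n x)) atTop (nhds (ENNReal.ofReal (g x))) := by
        simp_rw [a, b, ENNReal.mul_iSup]
        exact tendsto_atTop_iSup fun i j hij => mul_le_mul_right (hmono hij x) _
      have h2 := (ENNReal.tendsto_toReal ENNReal.ofReal_ne_top).comp h1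
      rw [ENNReal.toReal_ofReal c] at h2
      refine h2.congr fun n => ENNReal.toReal_ofReal (d n)
    have hUf := ae_iSup_ofReal_map_eq hp hU (hf0 0) hfm hlim
    rw [lintegral_iSup hφ hmono]
    simp_rw [fun n => ih n (f n) (hf0 n) (hf' n)]
    rw [← lintegral_iSup' (fun n => (hwm _).aemeasurable)]
    · refine lintegral_congr_ae ?_
      filter_upwards [hUf] with y hy
      rw [← hy.2, ENNReal.mul_iSup]
    · filter_upwards [hUf] with y hy i j hij
      exact mul_le_mul_right (hy.1 hij) _

theorem exists_density_of_le {Ω : Type*} [MeasurableSpace Ω] {μ : Measure Ω} [SigmaFinite μ]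
    {S : Set Ω → Ω → ℝ≥0∞} (hSm : ∀ B, Measurable (S B))
    (hS0 : ∀ B, MeasurableSet B → μ B = 0 → ∀ᵐ x ∂μ, S B x = 0)
    (hSU : ∀ B : ℕ → Set Ω, (∀ i, MeasurableSet (B i)) → Pairwise (Function.onFun Disjoint B) →
      ∀ᵐ x ∂μ, S (⋃ i, B i) x = ∑' i, S (B i) x)
    (hfin : ∫⁻ x, S Set.univ x ∂μ ≠ ∞) {j : Ω × Ω → ℝ≥0∞} (hj : Measurable j) {C : ℝ≥0∞}
    (hC : C ≠ ∞) (hjC : ∀ z, j z ≤ C) :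
    ∃ l : Ω × Ω → ℝ≥0∞, Measurable l ∧ ∀ B, MeasurableSet B →
      ∀ᵐ z ∂μ, ∫⁻ y in B, l (z, y) ∂μ = ∫⁻ x, j (z, x) * S B x ∂μ := by
  have hm : ∀ B, Measurable fun z : Ω × Ω => j z * S B z.2 :=
    fun B => hj.mul ((hSm B).comp measurable_snd)
  have hmz : ∀ B z, Measurable fun x => j (z, x) * S B x :=
    fun B z => (hm B).comp measurable_prodMk_left
  have hnull : ∀ B z, MeasurableSet B → μ B = 0 → ∫⁻ x, j (z, x) * S B x ∂μ = 0 := by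
    intro B z hB hB0
    refine lintegral_eq_zero_of_ae_eq_zero ?_
    filter_upwards [hS0 B hB hB0] with x hx
    rw [hx, mul_zero, Pi.zero_apply]
  let ν : Ω → Measure Ω := fun z =>
    Measure.ofMeasurable (fun B _ => ∫⁻ x, j (z, x) * S B x ∂μ)
      (hnull ∅ z MeasurableSet.empty measure_empty) (by
        intro B hB hd
        rw [← lintegral_tsum fun i => (hmz (B i) z).aemeasurable]
        refine lintegral_congr_ae ?_
        filter_upwards [hSU B hB hd] with x hx
        rw [hx, ENNReal.tsum_mul_left])
  have hν : ∀ z B, MeasurableSet B → ν z B = ∫⁻ x, j (z, x) * S B x ∂μ :=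
    fun z B hB => Measure.ofMeasurable_apply B hB
  let κ : ProbabilityTheory.Kernel Ω Ω := ⟨ν, Measure.measurable_of_measurable_coe _
    fun B hB => by simpa only [hν _ B hB] using (hm B).lintegral_prod_right'⟩
  have hκ : ProbabilityTheory.IsFiniteKernel κ := by
    refine ⟨C * ∫⁻ x, S Set.univ x ∂μ, ENNReal.mul_lt_top hC.lt_top hfin.lt_top, fun z => ?_⟩
    change ν z Set.univ ≤ _
    rw [hν z _ MeasurableSet.univ, ← lintegral_const_mul _ (hSm _)]
    exact lintegral_mono fun x => mul_le_mul_left (hjC _) _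
  have hac : μ.compProd κ ≪ μ.prod μ := by
    refine Measure.AbsolutelyContinuous.mk fun E hE hE0 => ?_
    rw [Measure.compProd_apply hE]
    refine lintegral_eq_zero_of_ae_eq_zero ?_
    filter_upwards [Measure.measure_ae_null_of_prod_null hE0] with z hz
    have hEz : MeasurableSet (Prod.mk z ⁻¹' E) := measurable_prodMk_left hE
    change ν z _ = 0
    rw [hν z _ hEz]
    exact hnull _ z hEz hz
  refine ⟨(μ.compProd κ).rnDeriv (μ.prod μ), Measure.measurable_rnDeriv _ _, fun B hB => ?_⟩
  have hl := Measure.measurable_rnDeriv (μ.compProd κ) (μ.prod μ)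
  refine ae_eq_of_forall_setLIntegral_eq_of_sigmaFinite hl.lintegral_prod_right'
    (hm B).lintegral_prod_right' fun A hA _ => ?_
  have h1 : (μ.compProd κ) (A ×ˢ B) = ∫⁻ z in A, ν z B ∂μ := Measure.compProd_apply_prod hA hB
  simp only [hν _ B hB] at h1
  rw [← h1, ← Measure.setLIntegral_rnDeriv hac, ← Measure.prod_restrict,
    lintegral_prod _ hl.aemeasurable]

theorem exists_density {Ω : Type*} [MeasurableSpace Ω] {μ : Measure Ω} [SigmaFinite μ]
    {S : Set Ω → Ω → ℝ≥0∞} (hSm : ∀ B, Measurable (S B))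
    (hS0 : ∀ B, MeasurableSet B → μ B = 0 → ∀ᵐ x ∂μ, S B x = 0)
    (hSU : ∀ B : ℕ → Set Ω, (∀ i, MeasurableSet (B i)) → Pairwise (Function.onFun Disjoint B) →
      ∀ᵐ x ∂μ, S (⋃ i, B i) x = ∑' i, S (B i) x)
    (hfin : ∫⁻ x, S Set.univ x ∂μ ≠ ∞) {j : Ω × Ω → ℝ≥0∞} (hj : Measurable j)
    (hjfin : ∀ z, j z ≠ ∞) :
    ∃ l : Ω × Ω → ℝ≥0∞, Measurable l ∧ ∀ B, MeasurableSet B →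
      ∀ᵐ z ∂μ, ∫⁻ y in B, l (z, y) ∂μ = ∫⁻ x, j (z, x) * S B x ∂μ := by
  let D : ℕ → Set (Ω × Ω) := fun n => {z | ⌊(j z).toNNReal⌋₊ = n}
  have hD : ∀ n, MeasurableSet (D n) :=
    fun n => (Nat.measurable_floor.comp hj.ennreal_toNNReal) (measurableSet_singleton n)
  have hjm : ∀ n, Measurable ((D n).indicator j) := fun n => hj.indicator (hD n)
  have hbd : ∀ n z, (D n).indicator j z ≤ ((n + 1 : ℕ) : ℝ≥0∞) := by
    intro n z
    refine Set.indicator_apply_le' (fun hz => ?_) fun _ => zero_le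
    rw [← ENNReal.coe_toNNReal (hjfin z)]
    have h1 := (Nat.lt_floor_add_one (j z).toNNReal).le
    rw [show ⌊(j z).toNNReal⌋₊ = n from hz] at h1
    exact_mod_cast h1
  have hsum : ∀ z, ∑' n, (D n).indicator j z = j z := by
    intro z
    have hz : ∀ n, n ≠ ⌊(j z).toNNReal⌋₊ → (D n).indicator j z = 0 :=
      fun n hn => Set.indicator_of_notMem (s := D n) (fun h => hn (Eq.symm h)) _
    rw [tsum_eq_single _ hz]
    exact Set.indicator_of_mem (show z ∈ D _ from rfl) _
  choose l hl hlB using fun n =>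
    exists_density_of_le hSm hS0 hSU hfin (hjm n) (ENNReal.natCast_ne_top (n + 1)) (hbd n)
  refine ⟨fun z => ∑' n, l n z, Measurable.tsum hl, fun B hB => ?_⟩
  filter_upwards [ae_all_iff.2 fun n => hlB n B hB] with z hz
  have hlz : ∀ n, Measurable fun y => l n (z, y) := fun n => (hl n).comp measurable_prodMk_left
  have hjz : ∀ n, Measurable fun x => (D n).indicator j (z, x) * S B x :=
    fun n => ((hjm n).comp measurable_prodMk_left).mul (hSm B)
  rw [lintegral_tsum fun n => (hlz n).aemeasurable]
  simp_rw [hz]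
  rw [← lintegral_tsum fun n => (hjz n).aemeasurable]
  simp_rw [ENNReal.tsum_mul_right, hsum]

theorem lintegral_indicator_mul {Ω : Type*} [MeasurableSpace Ω] {μ : Measure Ω} {B : Set Ω}
    (hB : MeasurableSet B) (v F : Ω → ℝ≥0∞) :
    ∫⁻ y, B.indicator v y * F y ∂μ = ∫⁻ y in B, v y * F y ∂μ := by
  rw [← lintegral_indicator hB]
  exact lintegral_congr fun y => (Set.indicator_mul_left B v F).symm

theorem ae_lintegral_mul_eq_of_indicatorLp {Ω : Type*} [MeasurableSpace Ω] {μ : Measure Ω}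
    [SigmaFinite μ] {p : ℝ≥0∞} [Fact (1 ≤ p)] (hp : p ≠ ∞) {U : Lp ℝ p μ →L[ℝ] Lp ℝ p μ}
    (hU : IsPositiveOp U) {h : Lp ℝ p μ} (hh : ∀ᵐ x ∂μ, 0 < h x) {L : Ω × Ω → ℝ≥0∞}
    (hL : Measurable L)
    (hLU : ∀ A, MeasurableSet A → ∀ᵐ y ∂μ,
      ∫⁻ x in A, L (y, x) * ENNReal.ofReal (h x) ∂μ = ENNReal.ofReal (U (indicatorLp h A) y))
    {g : Lp ℝ p μ} (hg : 0 ≤ g) :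
    ∀ᵐ y ∂μ, ∫⁻ x, L (y, x) * ENNReal.ofReal (g x) ∂μ = ENNReal.ofReal (U g y) := by
  have hLf : ∀ f : Lp ℝ p μ, Measurable fun z : Ω × Ω => L z * ENNReal.ofReal (f z.2) :=
    fun f => hL.mul ((measurable_ofReal_Lp f).comp measurable_snd)
  refine ae_eq_of_forall_setLIntegral_eq_of_sigmaFinite (hLf g).lintegral_prod_right'
    (measurable_ofReal_Lp _) fun B hB _ => ?_
  let d : Ω → ℝ≥0∞ := fun x => ∫⁻ y in B, L (y, x) ∂μ
  have hd : Measurable d := hL.lintegral_prod_left'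
  have hswap : ∀ (f : Lp ℝ p μ) (A : Set Ω),
      ∫⁻ y in B, ∫⁻ x in A, L (y, x) * ENNReal.ofReal (f x) ∂μ ∂μ =
        ∫⁻ x in A, d x * ENNReal.ofReal (f x) ∂μ := fun f A => by
    rw [lintegral_lintegral_swap (hLf f).aemeasurable]
    exact lintegral_congr fun x => lintegral_mul_const _ (hL.comp measurable_prodMk_right)
  have hβ : ∀ A, MeasurableSet A →
      (μ.withDensity fun x => d x * ENNReal.ofReal (h x)) A =
        ∫⁻ y, B.indicator 1 y * ENNReal.ofReal (U (indicatorLp h A) y) ∂μ := fun A hA => by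
    rw [withDensity_apply _ hA, ← hswap h A, lintegral_indicator_mul hB]
    simp_rw [Pi.one_apply, one_mul]
    exact lintegral_congr_ae (ae_restrict_of_ae (hLU A hA))
  have hdh : Measurable fun x => d x * ENNReal.ofReal (h x) := hd.mul (measurable_ofReal_Lp h)
  have hφ : Measurable fun x => ENNReal.ofReal (g x) / ENNReal.ofReal (h x) :=
    (measurable_ofReal_Lp g).div (measurable_ofReal_Lp h)
  have key := lintegral_eq_of_map_indicatorLp hp hU hh (measurable_one.indicator hB) hβ hφ g hg (by
    filter_upwards [hh] with x hx
    rw [ENNReal.mul_div_cancel (by simpa using hx) ENNReal.ofReal_ne_top])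
  rw [lintegral_indicator_mul hB] at key
  simp_rw [Pi.one_apply, one_mul] at key
  rw [← key, lintegral_withDensity_eq_lintegral_mul _ hdh hφ]
  have hg' := hswap g Set.univ
  rw [Measure.restrict_univ] at hg'
  refine hg'.trans (lintegral_congr_ae ?_)
  filter_upwards [hh] with x hx
  rw [Pi.mul_apply, mul_assoc, ENNReal.mul_div_cancel (by simpa using hx) ENNReal.ofReal_ne_top]

theorem isIntegralOp_of_indicatorLp {Ω : Type*} [MeasurableSpace Ω] {μ : Measure Ω}
    [SigmaFinite μ] {p : ℝ≥0∞} [Fact (1 ≤ p)] (hp : p ≠ ∞) {U : Lp ℝ p μ →L[ℝ] Lp ℝ p μ}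
    (hU : IsPositiveOp U) {h : Lp ℝ p μ} (hh : ∀ᵐ x ∂μ, 0 < h x) {L : Ω × Ω → ℝ≥0∞}
    (hL : Measurable L)
    (hLU : ∀ A, MeasurableSet A → ∀ᵐ y ∂μ,
      ∫⁻ x in A, L (y, x) * ENNReal.ofReal (h x) ∂μ = ENNReal.ofReal (U (indicatorLp h A) y)) :
    IsIntegralOp U := by
  have hLm : ∀ y, Measurable fun x => L (y, x) := fun y => hL.comp measurable_prodMk_left
  have hLtop : ∀ᵐ y ∂μ, ∀ᵐ x ∂μ, L (y, x) ≠ ∞ := by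
    filter_upwards [hLU Set.univ MeasurableSet.univ] with y hy
    rw [setLIntegral_univ] at hy
    filter_upwards [hh, ae_lt_top ((hLm y).mul (measurable_ofReal_Lp h))
      (hy.trans_ne ENNReal.ofReal_ne_top)] with x hx hlt htop
    rw [Pi.mul_apply, htop, ENNReal.top_mul (by simpa using hx)] at hlt
    exact lt_irrefl _ hlt
  refine ⟨fun x y => (L (y, x)).toReal, (hL.comp measurable_swap).ennreal_toReal,
    fun _ _ => ENNReal.toReal_nonneg, fun f => ?_⟩
  have hpos := ae_lintegral_mul_eq_of_indicatorLp hp hU hh hL hLU (g := f ⊔ 0) le_sup_right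
  have hneg := ae_lintegral_mul_eq_of_indicatorLp hp hU hh hL hLU (g := -f ⊔ 0) le_sup_right
  have hfp : ∀ᵐ x ∂μ, ENNReal.ofReal ((f ⊔ 0 : Lp ℝ p μ) x) = ENNReal.ofReal (f x) := by
    filter_upwards [Lp.coeFn_sup f 0, Lp.coeFn_zero ℝ p μ] with x h1 h2
    rw [h1, Pi.sup_apply, h2, Pi.zero_apply, ENNReal.ofReal_max, ENNReal.ofReal_zero,
      max_eq_left zero_le]
  have hfn : ∀ᵐ x ∂μ, ENNReal.ofReal ((-f ⊔ 0 : Lp ℝ p μ) x) = ENNReal.ofReal (-f x) := by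
    filter_upwards [Lp.coeFn_sup (-f) 0, Lp.coeFn_zero ℝ p μ, Lp.coeFn_neg f] with x h1 h2 h3
    rw [h1, Pi.sup_apply, h2, h3, Pi.zero_apply, Pi.neg_apply, ENNReal.ofReal_max,
      ENNReal.ofReal_zero, max_eq_left zero_le]
  have hboth : ∀ᵐ y ∂μ, Integrable (fun x => (L (y, x)).toReal * f x) μ ∧
      (U f) y = ∫ x, (L (y, x)).toReal * f x ∂μ := by
    have hUf : U f = U (f ⊔ 0) - U (-f ⊔ 0) := by
      rw [← map_sub]
      congr 1
      exact (posPart_sub_negPart f).symm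
    rw [hUf]
    filter_upwards [hpos, hneg, hLtop, Lp.coeFn_sub (U (f ⊔ 0)) (U (-f ⊔ 0)),
      (Lp.coeFn_nonneg _).2 (hU (f ⊔ 0) le_sup_right),
      (Lp.coeFn_nonneg _).2 (hU (-f ⊔ 0) le_sup_right)] with y hy1 hy2 hy3 hy4 hy5 hy6
    have e1 : ∫⁻ x, ENNReal.ofReal ((L (y, x)).toReal * f x) ∂μ =
        ENNReal.ofReal (U (f ⊔ 0) y) := by
      rw [← hy1]
      refine lintegral_congr_ae ?_
      filter_upwards [hfp, hy3] with x h1 h2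
      rw [h1, ENNReal.ofReal_mul ENNReal.toReal_nonneg, ENNReal.ofReal_toReal h2]
    have e2 : ∫⁻ x, ENNReal.ofReal (-((L (y, x)).toReal * f x)) ∂μ =
        ENNReal.ofReal (U (-f ⊔ 0) y) := by
      rw [← hy2]
      refine lintegral_congr_ae ?_
      filter_upwards [hfn, hy3] with x h1 h2
      rw [h1, ← mul_neg, ENNReal.ofReal_mul ENNReal.toReal_nonneg, ENNReal.ofReal_toReal h2]
    have hmeas : Measurable fun x => (L (y, x)).toReal * f x :=
      (hLm y).ennreal_toReal.mul (Lp.stronglyMeasurable f).measurable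
    have hint : Integrable (fun x => (L (y, x)).toReal * f x) μ := by
      refine ⟨hmeas.aestronglyMeasurable, ?_⟩
      rw [hasFiniteIntegral_iff_norm]
      have habs : ∀ a : ℝ, ENNReal.ofReal ‖a‖ = ENNReal.ofReal a + ENNReal.ofReal (-a) := by
        intro a
        rcases le_total 0 a with ha | ha
        · rw [Real.norm_of_nonneg ha, ENNReal.ofReal_of_nonpos (neg_nonpos.2 ha), add_zero]
        · rw [Real.norm_of_nonpos ha, ENNReal.ofReal_of_nonpos ha, zero_add]
      simp_rw [habs]
      rw [lintegral_add_left hmeas.ennreal_ofReal, e1, e2]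
      exact ENNReal.add_lt_top.2 ⟨ENNReal.ofReal_lt_top, ENNReal.ofReal_lt_top⟩
    refine ⟨hint, ?_⟩
    rw [integral_eq_lintegral_pos_part_sub_lintegral_neg_part hint, e1, e2,
      ENNReal.toReal_ofReal hy5, ENNReal.toReal_ofReal hy6, hy4, Pi.sub_apply]
  exact ⟨hboth.mono fun _ h => h.1, hboth.mono fun _ h => h.2⟩

theorem exists_pos_lintegral_mul_ne_top {Ω : Type*} [MeasurableSpace Ω] (μ : Measure Ω)
    [SigmaFinite μ] {t : Ω → ℝ≥0∞} (ht : Measurable t) (htop : ∀ x, t x ≠ ∞) :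
    ∃ v : Ω → ℝ≥0∞, Measurable v ∧ (∀ x, v x ≠ 0) ∧ (∀ x, v x ≠ ∞) ∧
      ∫⁻ x, v x * t x ∂μ ≠ ∞ := by
  obtain ⟨g, hg0, hgm, hg⟩ := exists_pos_lintegral_lt_of_sigmaFinite μ one_ne_zero
  refine ⟨fun x => g x / (1 + t x), hgm.coe_nnreal_ennreal.div (ht.const_add 1), fun x => ?_,
    fun x => ?_, ?_⟩
  · exact ENNReal.div_ne_zero.2 ⟨by exact_mod_cast (hg0 x).ne',
      ENNReal.add_ne_top.2 ⟨ENNReal.one_ne_top, htop x⟩⟩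
  · exact ENNReal.div_ne_top ENNReal.coe_ne_top (by simp)
  · refine ((lintegral_mono fun x => ?_).trans_lt (hg.trans ENNReal.one_lt_top)).ne
    beta_reduce
    rw [div_eq_mul_inv, mul_assoc, mul_comm _ (t x), ← div_eq_mul_inv]
    exact mul_le_of_le_one_right' (ENNReal.div_le_of_le_mul (by simp))

theorem ae_lintegral_kernel_eq {Ω : Type*} [MeasurableSpace Ω] {μ : Measure Ω} {p : ℝ≥0∞}
    [Fact (1 ≤ p)] {K : Lp ℝ p μ →L[ℝ] Lp ℝ p μ} {k : Ω → Ω → ℝ} (hk0 : ∀ x y, 0 ≤ k x y)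
    (hk : ∀ f : Lp ℝ p μ, (∀ᵐ y ∂μ, Integrable (fun x => k x y * f x) μ) ∧
      (K f : Ω → ℝ) =ᵐ[μ] fun y => ∫ x, k x y * f x ∂μ)
    {g : Lp ℝ p μ} (hg : 0 ≤ g) :
    ∀ᵐ y ∂μ, ∫⁻ x, ENNReal.ofReal (k x y) * ENNReal.ofReal (g x) ∂μ =
      ENNReal.ofReal (K g y) := by
  filter_upwards [(hk g).1, (hk g).2] with y h1 h2
  rw [h2, ofReal_integral_eq_lintegral_ofReal h1]
  · simp_rw [ENNReal.ofReal_mul (hk0 _ y)]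
  · filter_upwards [(Lp.coeFn_nonneg _).2 hg] with x hx
    exact mul_nonneg (hk0 x y) hx

theorem isIntegralOp_integralOp_comp {Ω : Type*} [MeasurableSpace Ω] {μ : Measure Ω}
    [SigmaFinite μ] {p : ℝ≥0∞} [Fact (1 ≤ p)] (hp : p ≠ ∞) {K T : Lp ℝ p μ →L[ℝ] Lp ℝ p μ}
    (hK : IsPositiveOp K) (hKker : IsIntegralOp K) (hT : IsPositiveOp T) :
    IsIntegralOp (K.comp T) := by
  obtain ⟨k, hkm, hk0, hk⟩ := hKker
  obtain ⟨h, hh⟩ := exists_pos_Lp μ (p := p)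
  obtain ⟨v, hv, hv0, hvtop, hvfin⟩ := exists_pos_lintegral_mul_ne_top μ
    (measurable_ofReal_Lp (T (indicatorLp h Set.univ))) fun _ => ENNReal.ofReal_ne_top
  obtain ⟨l, hl, hlA⟩ := exists_density (μ := μ)
    (S := fun A x => v x * ENNReal.ofReal (T (indicatorLp h A) x))
    (j := fun z => ENNReal.ofReal (k z.2 z.1) / v z.2)
    (fun A => hv.mul (measurable_ofReal_Lp _))
    (fun A hA hA0 => by
      filter_upwards [map_indicatorLp_of_null T h hA hA0] with x hx
      rw [hx, mul_zero])
    (fun A hA hd => by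
      filter_upwards [ae_ofReal_map_indicatorLp_iUnion hp hT hh hA hd] with x hx
      rw [hx, ENNReal.tsum_mul_left])
    hvfin ((hkm.comp measurable_swap).ennreal_ofReal.div (hv.comp measurable_snd))
    (fun z => ENNReal.div_ne_top ENNReal.ofReal_ne_top (hv0 _))
  refine isIntegralOp_of_indicatorLp hp (fun f hf => hK _ (hT f hf)) hh
    (L := fun z => l z / ENNReal.ofReal (h z.2))
    (hl.div ((measurable_ofReal_Lp h).comp measurable_snd)) fun A hA => ?_
  filter_upwards [hlA A hA, ae_lintegral_kernel_eq hk0 hk (hT _ (indicatorLp_nonneg hh hA))]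
    with y h1 h2
  rw [ContinuousLinearMap.comp_apply, ← h2]
  refine Eq.trans (lintegral_congr_ae (ae_restrict_of_ae ?_)) (h1.trans ?_)
  · filter_upwards [hh] with x hx
    exact ENNReal.div_mul_cancel (by simpa using hx) ENNReal.ofReal_ne_top
  · refine lintegral_congr fun x => ?_
    rw [← mul_assoc, ENNReal.div_mul_cancel (hv0 x) (hvtop x)]

/-- The functions `q B` play the role of the transpose of `T` applied to `B.indicator v`. -/
theorem exists_transpose_indicator {Ω : Type*} [MeasurableSpace Ω] {μ : Measure Ω}
    [SigmaFinite μ] {p : ℝ≥0∞} [Fact (1 ≤ p)] (hp : p ≠ ∞) {T : Lp ℝ p μ →L[ℝ] Lp ℝ p μ}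
    (hT : IsPositiveOp T) {h : Lp ℝ p μ} (hh : ∀ᵐ x ∂μ, 0 < h x) {v : Ω → ℝ≥0∞}
    (hv : Measurable v)
    (hvfin : ∫⁻ y, v y * ENNReal.ofReal (T (indicatorLp h Set.univ) y) ∂μ ≠ ∞) :
    ∃ q : Set Ω → Ω → ℝ≥0∞, (∀ B, Measurable (q B)) ∧
      ∀ B, MeasurableSet B → ∀ A, MeasurableSet A →
        ∫⁻ x in A, q B x ∂μ = ∫⁻ y in B, v y * ENNReal.ofReal (T (indicatorLp h A) y) ∂μ := by
  have hex : ∀ B : Set Ω, ∃ q : Ω → ℝ≥0∞, Measurable q ∧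
      (MeasurableSet B → ∀ A, MeasurableSet A →
        ∫⁻ x in A, q x ∂μ = ∫⁻ y in B, v y * ENNReal.ofReal (T (indicatorLp h A) y) ∂μ) := by
    intro B
    by_cases hB : MeasurableSet B
    · obtain ⟨β, hβ⟩ := exists_measure_map_indicatorLp hp hT hh (hv.indicator hB)
      simp_rw [lintegral_indicator_mul hB] at hβ
      have : IsFiniteMeasure β := ⟨by
        rw [hβ _ MeasurableSet.univ]
        exact (setLIntegral_le_lintegral _ _).trans_lt hvfin.lt_top⟩
      have hac : β ≪ μ := by
        refine Measure.AbsolutelyContinuous.mk fun A hA hA0 => ?_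
        rw [hβ A hA]
        refine lintegral_eq_zero_of_ae_eq_zero (ae_restrict_of_ae ?_)
        filter_upwards [map_indicatorLp_of_null T h hA hA0] with x hx
        rw [hx, mul_zero, Pi.zero_apply]
      refine ⟨β.rnDeriv μ, Measure.measurable_rnDeriv _ _, fun _ A hA => ?_⟩
      rw [Measure.setLIntegral_rnDeriv hac, hβ A hA]
    · exact ⟨0, measurable_zero, fun h => absurd h hB⟩
  choose q hqm hq using hex
  exact ⟨q, hqm, hq⟩

theorem isIntegralOp_comp_integralOp {Ω : Type*} [MeasurableSpace Ω] {μ : Measure Ω}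
    [SigmaFinite μ] {p : ℝ≥0∞} [Fact (1 ≤ p)] (hp : p ≠ ∞) {K T : Lp ℝ p μ →L[ℝ] Lp ℝ p μ}
    (hK : IsPositiveOp K) (hKker : IsIntegralOp K) (hT : IsPositiveOp T) :
    IsIntegralOp (T.comp K) := by
  obtain ⟨k, hkm, hk0, hk⟩ := hKker
  obtain ⟨h, hh⟩ := exists_pos_Lp μ (p := p)
  have hhm : Measurable fun x => ENNReal.ofReal (h x) := measurable_ofReal_Lp h
  obtain ⟨v, hv, hv0, hvtop, hvfin⟩ := exists_pos_lintegral_mul_ne_top μ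
    (measurable_ofReal_Lp (T (indicatorLp h Set.univ))) fun _ => ENNReal.ofReal_ne_top
  obtain ⟨q, hqm, hq⟩ := exists_transpose_indicator hp hT hh hv hvfin
  let j : Ω × Ω → ℝ≥0∞ := fun z => ENNReal.ofReal (k z.1 z.2 / h z.2)
  have hj : Measurable j :=
    (hkm.div ((Lp.stronglyMeasurable h).measurable.comp measurable_snd)).ennreal_ofReal
  obtain ⟨l, hl, hlB⟩ := exists_density (μ := μ) (S := q) (j := j) hqm
    (fun B hB hB0 => by
      have h1 := hq B hB Set.univ MeasurableSet.univ
      rw [setLIntegral_univ, setLIntegral_measure_zero _ _ hB0] at h1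
      exact (lintegral_eq_zero_iff (hqm B)).1 h1)
    (fun B hB hd => by
      refine ae_eq_of_forall_setLIntegral_eq_of_sigmaFinite (hqm _)
        (Measurable.tsum fun i => hqm (B i)) fun A hA _ => ?_
      rw [hq _ (MeasurableSet.iUnion hB) A hA, lintegral_iUnion hB hd,
        lintegral_tsum fun i => (hqm (B i)).aemeasurable]
      exact tsum_congr fun i => (hq _ (hB i) A hA).symm)
    (by
      have h1 := hq _ MeasurableSet.univ _ MeasurableSet.univ
      rw [setLIntegral_univ, setLIntegral_univ] at h1
      rwa [h1])
    hj (fun z => ENNReal.ofReal_ne_top)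
  refine isIntegralOp_of_indicatorLp hp (fun f hf => hT _ (hK f hf)) hh
    (L := fun z => l (z.2, z.1) / v z.1)
    ((hl.comp measurable_swap).div (hv.comp measurable_fst)) fun A hA => ?_
  have hlh : Measurable fun z : Ω × Ω => l (z.2, z.1) * ENNReal.ofReal (h z.2) :=
    (hl.comp measurable_swap).mul (hhm.comp measurable_snd)
  have hjq : ∀ B, Measurable fun z : Ω × Ω => j z * q B z.2 * ENNReal.ofReal (h z.1) :=
    fun B => (hj.mul ((hqm B).comp measurable_snd)).mul (hhm.comp measurable_fst)
  have hKA := hK _ (indicatorLp_nonneg hh hA)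
  have hjK : ∀ᵐ y ∂μ, ∫⁻ x in A, j (x, y) * ENNReal.ofReal (h x) ∂μ =
      ENNReal.ofReal (K (indicatorLp h A) y) / ENNReal.ofReal (h y) := by
    filter_upwards [ae_lintegral_kernel_eq hk0 hk (indicatorLp_nonneg hh hA), hh] with y h1 hy
    rw [← h1, div_eq_mul_inv, ← lintegral_mul_const' _ _ (by simpa using hy),
      ← lintegral_indicator hA]
    refine lintegral_congr_ae ?_
    filter_upwards [coeFn_indicatorLp h hA] with x hx
    by_cases hxA : x ∈ A
    · simp only [hx, Set.indicator_of_mem hxA, j]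
      rw [ENNReal.ofReal_div_of_pos hy, div_eq_mul_inv]
      ring
    · simp [hx, hxA]
  have key : ∀ᵐ y ∂μ, ∫⁻ x in A, l (x, y) * ENNReal.ofReal (h x) ∂μ =
      v y * ENNReal.ofReal (T (K (indicatorLp h A)) y) := by
    refine ae_eq_of_forall_setLIntegral_eq_of_sigmaFinite hlh.lintegral_prod_right'
      (hv.mul (measurable_ofReal_Lp _)) fun B hB _ => ?_
    have hφ : Measurable fun x =>
        ENNReal.ofReal (K (indicatorLp h A) x) / ENNReal.ofReal (h x) :=
      (measurable_ofReal_Lp _).div hhm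
    have hE := lintegral_eq_of_map_indicatorLp hp hT hh (hv.indicator hB)
      (β := μ.withDensity (q B))
      (fun C hC => by
        rw [withDensity_apply _ hC, hq B hB C hC, lintegral_indicator_mul hB]) hφ _ hKA
      (by
        filter_upwards [hh] with x hx
        rw [ENNReal.mul_div_cancel (by simpa using hx) ENNReal.ofReal_ne_top])
    rw [lintegral_indicator_mul hB,
      lintegral_withDensity_eq_lintegral_mul _ (hqm B) hφ] at hE
    rw [← hE, lintegral_lintegral_swap hlh.aemeasurable]
    calc ∫⁻ x in A, ∫⁻ y in B, l (x, y) * ENNReal.ofReal (h x) ∂μ ∂μ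
        = ∫⁻ x in A, ∫⁻ y, j (x, y) * q B y * ENNReal.ofReal (h x) ∂μ ∂μ := by
          refine lintegral_congr_ae (ae_restrict_of_ae ?_)
          filter_upwards [hlB B hB] with x hx
          have hlx : Measurable fun y => l (x, y) := hl.comp measurable_prodMk_left
          have hjx : Measurable fun y => j (x, y) * q B y :=
            (hj.comp measurable_prodMk_left).mul (hqm B)
          rw [lintegral_mul_const _ hlx, hx, lintegral_mul_const _ hjx]
      _ = ∫⁻ y, ∫⁻ x in A, j (x, y) * q B y * ENNReal.ofReal (h x) ∂μ ∂μ :=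
          lintegral_lintegral_swap (hjq B).aemeasurable
      _ = _ := by
          refine lintegral_congr_ae ?_
          filter_upwards [hjK] with y hy
          rw [Pi.mul_apply, ← hy, ← lintegral_const_mul]
          · exact lintegral_congr fun x => by ring
          · exact (hj.comp measurable_prodMk_right).mul hhm
  filter_upwards [key] with y hy
  rw [ContinuousLinearMap.comp_apply, ← ENNReal.mul_right_inj (hv0 y) (hvtop y), ← hy,
    ← lintegral_const_mul' _ _ (hvtop y)]
  refine lintegral_congr fun x => ?_
  rw [← mul_assoc, ENNReal.mul_div_cancel (hv0 y) (hvtop y)]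

/-- The composition of a positive integral operator with a positive bounded operator
(in either order) is again an integral operator. -/
theorem comp_integralOp
    {Ω : Type*} [MeasurableSpace Ω] (μ : Measure Ω) [SigmaFinite μ]
    (p : ℝ≥0∞) [Fact (1 ≤ p)] (hp : p ≠ ∞)
    (K T : Lp ℝ p μ →L[ℝ] Lp ℝ p μ)
    (hKpos : IsPositiveOp K) (hKker : IsIntegralOp K)
    (hTpos : IsPositiveOp T) :
    IsIntegralOp (K.comp T) ∧ IsIntegralOp (T.comp K) :=
  ⟨isIntegralOp_integralOp_comp hp hKpos hKker hTpos,
    isIntegralOp_comp_integralOp hp hKpos hKker hTpos⟩
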